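/- arXiv:1903.07940 — 2 statements merged into one kernel-verified Lean document; each statement's English description precedes it below -/
import Mathlib

section
/- Let ε ∈ (0,1), A ∈ ℝ with A ≠ 0, and let r ∈ ℝ satisfy |r − 1| > ε. Then there exists α₀ > 0 such that for every α ≥ α₀, the per-sample rollback objective at r is strictly less than its value at the old policy: L^RB_α(r) < A, where A = L^RB_α(1) is the objective value at likelihood ratio 1. -/
/-- Rollback function. -/
noncomputable def FRB (r ε α : ℝ) : ℝ :=
  if r ≤ 1 - ε then -α * r + (1 + α) * (1 - ε)
  else if 1 + ε ≤ r then -α * r + (1 + α) * (1 + ε)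
  else r

/-- Per-sample rollback objective. -/
noncomputable def LRB1 (ε α A r : ℝ) : ℝ := min (r * A) (FRB r ε α * A)

theorem FRB_of_le {r ε : ℝ} (α : ℝ) (h : r ≤ 1 - ε) :
    FRB r ε α = 1 - ε + α * (1 - ε - r) := by
  rw [FRB, if_pos h]
  ring

theorem FRB_of_ge {r ε : ℝ} (α : ℝ) (hε : 0 < ε) (h : 1 + ε ≤ r) :
    FRB r ε α = 1 + ε - α * (r - 1 - ε) := by
  rw [FRB, if_neg (by linarith), if_pos h]
  ring

/-- For a sufficiently large rollback coefficient, the per-sample rollback objective at an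
out-of-range ratio is strictly less than its value `A` at the old policy (ratio 1). -/
theorem rollback_lt_old_for_large_alpha (ε A r : ℝ) (hε : ε ∈ Set.Ioo (0 : ℝ) 1)
    (hA : A ≠ 0) (hr : ε < |r - 1|) :
    ∃ α₀ > (0 : ℝ), ∀ α ≥ α₀, LRB1 ε α A r < A := by
  obtain ⟨hε0, -⟩ := hε
  have hd : 0 < |r - 1| - ε := sub_pos.mpr hr
  refine ⟨2 * ε / (|r - 1| - ε), by positivity, fun α hα => ?_⟩
  have hα' : 2 * ε ≤ α * (|r - 1| - ε) := (div_le_iff₀ hd).mp hα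
  rw [LRB1, min_lt_iff]
  rcases lt_abs.mp hr with h | h
  · rcases hA.lt_or_gt with hA | hA
    · left
      nlinarith
    · right
      rw [abs_of_pos (by linarith)] at hα'
      rw [FRB_of_ge α hε0 (by linarith)]
      exact mul_lt_of_lt_one_left hA (by linarith)
  · rcases hA.lt_or_gt with hA | hA
    · right
      rw [abs_of_neg (by linarith)] at hα'
      rw [FRB_of_le α (by linarith)]
      have : 1 < 1 - ε + α * (1 - ε - r) := by linarith
      nlinarith
    · left
      nlinarith
end

section
/- Let ε ∈ (0,1), α > 0, and A ∈ ℝ with A ≠ 0. Then the function r ↦ L^RB_α(r) = min(r·A, F^RB(r,ε,α)·A) on ℝ has a unique global maximizer: it equals 1+ε if A > 0 and 1−ε if A < 0. In particular, every global maximizer r* of the per-sample rollback objective satisfies |r* − 1| ≤ ε. -/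
theorem FRB_one_add {ε : ℝ} (hε : 0 < ε) (α : ℝ) : FRB (1 + ε) ε α = 1 + ε := by
  rw [FRB, if_neg (by linarith), if_pos le_rfl]
  ring

theorem FRB_one_sub (ε α : ℝ) : FRB (1 - ε) ε α = 1 - ε := by
  rw [FRB, if_pos le_rfl]
  ring

theorem FRB_lt_one_add {r ε α : ℝ} (hε : 0 < ε) (hα : 0 < α) (hr : 1 + ε < r) :
    FRB r ε α < 1 + ε := by
  rw [FRB, if_neg (by linarith), if_pos hr.le]
  linarith [mul_pos hα (sub_pos.2 hr)]

theorem one_sub_lt_FRB {r ε α : ℝ} (hα : 0 < α) (hr : r < 1 - ε) : 1 - ε < FRB r ε α := by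
  rw [FRB, if_pos hr.le]
  linarith [mul_pos hα (sub_pos.2 hr)]

theorem LRB1_lt_of_pos {ε α A r : ℝ} (hε : 0 < ε) (hα : 0 < α) (hA : 0 < A)
    (hr : r ≠ 1 + ε) : LRB1 ε α A r < LRB1 ε α A (1 + ε) := by
  rw [LRB1, LRB1, FRB_one_add hε, min_self]
  rcases hr.lt_or_gt with h | h
  · exact min_lt_of_left_lt (mul_lt_mul_of_pos_right h hA)
  · exact min_lt_of_right_lt (mul_lt_mul_of_pos_right (FRB_lt_one_add hε hα h) hA)

theorem LRB1_lt_of_neg {ε α A r : ℝ} (hα : 0 < α) (hA : A < 0) (hr : r ≠ 1 - ε) :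
    LRB1 ε α A r < LRB1 ε α A (1 - ε) := by
  rw [LRB1, LRB1, FRB_one_sub, min_self]
  rcases hr.lt_or_gt with h | h
  · exact min_lt_of_right_lt (mul_lt_mul_of_neg_right (one_sub_lt_FRB hα h) hA)
  · exact min_lt_of_left_lt (mul_lt_mul_of_neg_right h hA)

/-- The per-sample rollback objective has a unique global maximizer, equal to `1+ε` if
`A > 0` and `1-ε` if `A < 0`; in particular, every global maximizer `r*` satisfies
`|r* - 1| ≤ ε`. -/
theorem rollback_unique_global_maximizer (ε α A : ℝ) (hε : ε ∈ Set.Ioo (0 : ℝ) 1)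
    (hα : 0 < α) (hA : A ≠ 0) :
    (∀ r : ℝ, LRB1 ε α A r ≤ LRB1 ε α A (if 0 < A then 1 + ε else 1 - ε)) ∧
    (∀ r : ℝ, (∀ r' : ℝ, LRB1 ε α A r' ≤ LRB1 ε α A r) →
      r = (if 0 < A then 1 + ε else 1 - ε)) ∧
    (∀ r : ℝ, (∀ r' : ℝ, LRB1 ε α A r' ≤ LRB1 ε α A r) → |r - 1| ≤ ε) := by
  have hlt : ∀ r : ℝ, r ≠ (if 0 < A then 1 + ε else 1 - ε) →
      LRB1 ε α A r < LRB1 ε α A (if 0 < A then 1 + ε else 1 - ε) := by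
    intro r hr
    split_ifs at hr ⊢ with h
    · exact LRB1_lt_of_pos hε.1 hα h hr
    · exact LRB1_lt_of_neg hα (lt_of_le_of_ne (not_lt.1 h) hA) hr
  have huniq : ∀ r : ℝ, (∀ r' : ℝ, LRB1 ε α A r' ≤ LRB1 ε α A r) →
      r = (if 0 < A then 1 + ε else 1 - ε) := by
    intro r hmax
    by_contra hr
    exact (hlt r hr).not_ge (hmax _)
  refine ⟨fun r => ?_, huniq, fun r hmax => ?_⟩
  · rcases eq_or_ne r (if 0 < A then 1 + ε else 1 - ε) with hr | hr
    · rw [← hr]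
    · exact (hlt r hr).le
  · have hε0 := hε.1
    rw [huniq r hmax, abs_le]
    split_ifs <;> constructor <;> linarith
end
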